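/- Let G be a graph with K vertices (given by a symmetric 0-1 adjacency matrix). For every integer N ≥ K + 1, the ground energy of the N-particle Bose–Hubbard model satisfies λ_N^1(G) ≥ 2. -/

import Mathlib

namespace BH

variable {V : Type*} [Fintype V] [DecidableEq V]

/-- The operator `M` acting on the `w`-th factor of the `N`-fold tensor power
`(ℂ^V)^{⊗N}`, the latter identified with `ℂ^{V^N}`. -/
noncomputable def onFactor (N : ℕ) (M : Matrix V V ℂ) (w : Fin N) :
    Matrix (Fin N → V) (Fin N → V) ℂ :=
  Matrix.of fun x y =>
    (if ∀ u, u ≠ w → x u = y u then (1 : ℂ) else 0) * M (x w) (y w)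

/-- The Bose–Hubbard interaction term
`Σ_{k ∈ V} Σ_{w ≠ w'} (|k⟩⟨k|)^{(w)} (|k⟩⟨k|)^{(w')}`, a diagonal matrix whose diagonal
entry at a configuration `x : Fin N → V` counts the ordered pairs of distinct particles
sitting at a common vertex. -/
noncomputable def interaction (V : Type*) [DecidableEq V] (N : ℕ) :
    Matrix (Fin N → V) (Fin N → V) ℂ :=
  Matrix.of fun x y =>
    if x = y then
      (((Finset.univ : Finset (Fin N × Fin N)).filter
          fun p => p.1 ≠ p.2 ∧ x p.1 = x p.2).card : ℂ)
    else 0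

/-- The `N`-particle Bose–Hubbard Hamiltonian `H_G^N` (with hopping and interaction
strengths equal to `1`) for the graph with adjacency matrix `A`. -/
noncomputable def bhHam (A : Matrix V V ℂ) (N : ℕ) :
    Matrix (Fin N → V) (Fin N → V) ℂ :=
  (∑ w : Fin N, onFactor N A w) + interaction V N

/-- The bosonic (symmetric) subspace `Z_N(G)`: states invariant under every permutation
of the `N` tensor factors. -/
def symmStates (V : Type*) (N : ℕ) : Set ((Fin N → V) → ℂ) :=
  { ψ | ∀ σ : Equiv.Perm (Fin N), ∀ x : Fin N → V, ψ (x ∘ σ) = ψ x }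

/-- The ground energy (smallest eigenvalue) of the compression of a Hermitian matrix `H`
to a subspace given as a set `Z` of states: the infimum of the Rayleigh quotients
`⟨ψ, H ψ⟩` over unit vectors `ψ ∈ Z`. -/
noncomputable def groundEnergy {ι : Type*} [Fintype ι]
    (H : Matrix ι ι ℂ) (Z : Set (ι → ℂ)) : ℝ :=
  sInf { r : ℝ | ∃ ψ ∈ Z, dotProduct (star ψ) ψ = 1 ∧
    r = (dotProduct (star ψ) (H.mulVec ψ)).re }

/-- `μ(G)`: the smallest eigenvalue of the adjacency matrix `A = A(G)`. -/
noncomputable def mu (A : Matrix V V ℂ) : ℝ :=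
  groundEnergy A Set.univ

/-- `λ_N^1(G)`: the smallest eigenvalue of `H(G,N)`, the restriction of
`H_G^N − N μ(G)·1` to the symmetric subspace `Z_N(G)`. -/
noncomputable def lambda1 (A : Matrix V V ℂ) (N : ℕ) : ℝ :=
  groundEnergy (bhHam A N - ((N : ℂ) * (mu A : ℂ)) • 1) (symmStates V N)

end BH

namespace BH

lemma dot_star_self {ι : Type*} [Fintype ι] (ψ : ι → ℂ) :
    dotProduct (star ψ) ψ = ((∑ i, ‖ψ i‖ ^ 2 : ℝ) : ℂ) := by
  simp only [dotProduct, Pi.star_apply, Complex.ofReal_sum]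
  refine Finset.sum_congr rfl fun i _ => ?_
  have := Complex.conj_mul' (ψ i)
  simpa using this

lemma bdd {ι : Type*} [Fintype ι] (H : Matrix ι ι ℂ) :
    BddBelow { r : ℝ | ∃ ψ ∈ (Set.univ : Set (ι → ℂ)), dotProduct (star ψ) ψ = 1 ∧
    r = (dotProduct (star ψ) (H.mulVec ψ)).re } := by
  refine ⟨-∑ i, ∑ j, ‖H i j‖, ?_⟩
  rintro r ⟨ψ, -, h1, rfl⟩
  rw [dot_star_self] at h1
  have h1' : ∑ i, ‖ψ i‖ ^ 2 = 1 := by exact_mod_cast h1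
  have hb : ∀ i, ‖ψ i‖ ≤ 1 := by
    intro i
    have : ‖ψ i‖ ^ 2 ≤ 1 := by
      rw [← h1']
      exact Finset.single_le_sum (f := fun i => ‖ψ i‖ ^ 2) (fun _ _ => by positivity)
        (Finset.mem_univ i)
    nlinarith [norm_nonneg (ψ i)]
  have hn : ‖dotProduct (star ψ) (H.mulVec ψ)‖ ≤ ∑ i, ∑ j, ‖H i j‖ := by
    simp only [dotProduct, Matrix.mulVec]
    refine (norm_sum_le _ _).trans (Finset.sum_le_sum fun i _ => ?_)
    rw [norm_mul]
    have h2 : ‖∑ j, H i j * ψ j‖ ≤ ∑ j, ‖H i j‖ := by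
      refine (norm_sum_le _ _).trans (Finset.sum_le_sum fun j _ => ?_)
      rw [norm_mul]
      exact mul_le_of_le_one_right (norm_nonneg _) (hb j)
    have h3 : ‖(star ψ) i‖ ≤ 1 := by simpa using hb i
    exact (mul_le_of_le_one_left (norm_nonneg _) h3).trans h2
  have := abs_le.mp (Complex.abs_re_le_norm (dotProduct (star ψ) (H.mulVec ψ)))
  linarith [this.1]

lemma mu_le {V : Type*} [Fintype V] (A : Matrix V V ℂ) (φ : V → ℂ) :
    mu A * ∑ i, ‖φ i‖ ^ 2 ≤ (dotProduct (star φ) (A.mulVec φ)).re := by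
  by_cases h0 : ∑ i, ‖φ i‖ ^ 2 = 0
  · have hz : φ = 0 := by
      funext i
      have := (Finset.sum_eq_zero_iff_of_nonneg (fun i _ => by positivity)).mp h0 i
        (Finset.mem_univ i)
      simpa using this
    subst hz
    simp
  · have hpos : 0 < ∑ i, ‖φ i‖ ^ 2 :=
      lt_of_le_of_ne (Finset.sum_nonneg fun i _ => by positivity) (Ne.symm h0)
    set S := ∑ i, ‖φ i‖ ^ 2 with hS
    obtain ⟨c, hc, hcS⟩ : ∃ c : ℝ, 0 < c ∧ c * c * S = 1 :=
      ⟨(Real.sqrt S)⁻¹, by positivity, by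
        rw [← mul_inv, Real.mul_self_sqrt hpos.le, inv_mul_cancel₀ h0]⟩
    have hst : star ((c : ℂ) • φ) = (c : ℂ) • star φ := by
      ext i; simp
    have key : mu A ≤ (dotProduct (star ((c : ℂ) • φ)) (A.mulVec ((c : ℂ) • φ))).re := by
      refine csInf_le (bdd A) ⟨(c : ℂ) • φ, Set.mem_univ _, ?_, rfl⟩
      rw [hst, smul_dotProduct, dotProduct_smul, dot_star_self, ← hS, smul_smul, smul_eq_mul]
      exact_mod_cast hcS
    rw [hst, Matrix.mulVec_smul, smul_dotProduct, dotProduct_smul, smul_smul, smul_eq_mul,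
      ← Complex.ofReal_mul, Complex.re_ofReal_mul] at key
    calc mu A * S ≤ (c * c * (dotProduct (star φ) (A.mulVec φ)).re) * S :=
          mul_le_mul_of_nonneg_right key hpos.le
      _ = (c * c * S) * (dotProduct (star φ) (A.mulVec φ)).re := by ring
      _ = _ := by rw [hcS, one_mul]

variable {V : Type*} [Fintype V] [DecidableEq V]

lemma onFactor_split (N : ℕ) (A : Matrix V V ℂ) (w : Fin N) (a b : V)
    (r s : {j // j ≠ w} → V) :
    onFactor N A w ((Equiv.funSplitAt w V).symm (a, r)) ((Equiv.funSplitAt w V).symm (b, s))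
      = if r = s then A a b else 0 := by
  have : (∀ u, u ≠ w → (Equiv.funSplitAt w V).symm (a, r) u
      = (Equiv.funSplitAt w V).symm (b, s) u) ↔ r = s := by
    constructor
    · intro h
      funext ⟨u, hu⟩
      simpa [hu] using h u hu
    · rintro rfl u hu
      simp [hu]
  simp only [onFactor, Matrix.of_apply, this]
  split_ifs <;> simp

lemma onFactor_ge (N : ℕ) (A : Matrix V V ℂ) (w : Fin N) (ψ : (Fin N → V) → ℂ) :
    mu A * ∑ x, ‖ψ x‖ ^ 2 ≤ (dotProduct (star ψ) ((onFactor N A w).mulVec ψ)).re := by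
  set e := (Equiv.funSplitAt w V).symm with he
  have h1 : ∑ x, ‖ψ x‖ ^ 2 = ∑ r, ∑ a, ‖ψ (e (a, r))‖ ^ 2 := by
    rw [← e.sum_comp, Fintype.sum_prod_type_right]
  have h2 : dotProduct (star ψ) ((onFactor N A w).mulVec ψ)
      = ∑ r, dotProduct (star fun a => ψ (e (a, r))) (A.mulVec fun a => ψ (e (a, r))) := by
    simp only [dotProduct, Matrix.mulVec]
    rw [← e.sum_comp, Fintype.sum_prod_type_right]
    refine Finset.sum_congr rfl fun r _ => Finset.sum_congr rfl fun a _ => ?_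
    congr 1
    rw [← e.sum_comp, Fintype.sum_prod_type]
    refine Finset.sum_congr rfl fun b _ => ?_
    simp only [he, onFactor_split]
    simp
  rw [h1, h2, Finset.mul_sum, Complex.re_sum]
  exact Finset.sum_le_sum fun r _ => mu_le A _

lemma interaction_ge (N : ℕ) (hN : Fintype.card V + 1 ≤ N) (ψ : (Fin N → V) → ℂ) :
    2 * ∑ x, ‖ψ x‖ ^ 2 ≤ (dotProduct (star ψ) ((interaction V N).mulVec ψ)).re := by
  simp only [dotProduct, Matrix.mulVec]
  rw [Complex.re_sum, Finset.mul_sum]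
  refine Finset.sum_le_sum fun x _ => ?_
  simp only [interaction, Matrix.of_apply, ite_mul, zero_mul, Finset.sum_ite_eq,
    Finset.mem_univ, if_true]
  set c := ((Finset.univ : Finset (Fin N × Fin N)).filter
          fun p => p.1 ≠ p.2 ∧ x p.1 = x p.2).card with hc
  have h2 : 2 ≤ c := by
    obtain ⟨i, j, hij, hx⟩ := Fintype.exists_ne_map_eq_of_card_lt x (by simp; omega)
    have : ({(i, j), (j, i)} : Finset (Fin N × Fin N)).card = 2 :=
      Finset.card_pair (by simp [hij])
    rw [← this]
    refine Finset.card_le_card ?_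
    intro p hp
    simp only [Finset.mem_insert, Finset.mem_singleton] at hp
    rcases hp with rfl | rfl
    · simp [hij, hx]
    · simp [hij.symm, hx]
  have h3 : (star ψ) x * ((c : ℂ) * ψ x) = ((c * ‖ψ x‖ ^ 2 : ℝ) : ℂ) := by
    have := Complex.conj_mul' (ψ x)
    push_cast
    rw [← this, Pi.star_apply, ← starRingEnd_apply]
    ring
  rw [h3, Complex.ofReal_re]
  have : (2 : ℝ) ≤ c := by exact_mod_cast h2
  gcongr

end BH

/-- Let `G` be a graph with `K` vertices (given by a symmetric 0-1
adjacency matrix).  For every integer `N ≥ K + 1`, the ground energy of the `N`-particle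
Bose–Hubbard model satisfies `λ_N^1(G) ≥ 2`. -/
theorem bh_overcrowding_bound
    {V : Type*} [Fintype V] [DecidableEq V] [Nonempty V]
    (A : Matrix V V ℂ) (hsymm : A.IsSymm)
    (h01 : ∀ i j, A i j = 0 ∨ A i j = 1)
    (N : ℕ) (hN : Fintype.card V + 1 ≤ N) :
    (2 : ℝ) ≤ BH.lambda1 A N := by
  unfold BH.lambda1 BH.groundEnergy
  refine le_csInf ?_ ?_
  · obtain ⟨v⟩ := ‹Nonempty V›
    refine ⟨_, Pi.single (fun _ => v) 1, ?_, ?_, rfl⟩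
    · intro σ x
      have : (x ∘ σ = fun _ => v) ↔ x = fun _ => v := by
        constructor
        · intro h
          funext i
          simpa using congrFun h (σ.symm i)
        · rintro rfl
          rfl
      simp only [Pi.single_apply, this]
    · rw [BH.dot_star_self]
      rw [Finset.sum_eq_single (fun _ => v)]
      · simp
      · intro b _ hb
        simp [Pi.single_apply, hb]
      · simp
  · rintro r ⟨ψ, -, h1, rfl⟩
    have hd := h1
    rw [BH.dot_star_self] at h1
    have h1' : ∑ i, ‖ψ i‖ ^ 2 = 1 := by exact_mod_cast h1
    have hI := BH.interaction_ge N hN ψ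
    have hF : ∀ w, _ := fun w => BH.onFactor_ge N A w ψ
    simp only [h1', mul_one] at hI hF
    have hsum := Finset.sum_le_sum fun w (_ : w ∈ (Finset.univ : Finset (Fin N))) => hF w
    rw [BH.bhHam, Matrix.sub_mulVec, Matrix.add_mulVec, Matrix.sum_mulVec, dotProduct_sub,
      dotProduct_add, dotProduct_sum, Matrix.smul_mulVec, Matrix.one_mulVec, dotProduct_smul,
      hd, Complex.sub_re, Complex.add_re, Complex.re_sum]
    simp at hsum ⊢
    linarith
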